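/- Let G be a finite simple graph on at least two vertices with minimum degree δ ≥ 1, let k be a positive integer, and let S be a minimum k-forcing set of G (i.e., S is a k-forcing set with |S| = F_k(G)). Then for every vertex v ∈ S there are at least min{deg(v), k} vertices in V - S adjacent to v. -/

import Mathlib

open Finset SimpleGraph

/-- One round of the `k`-forcing color change rule: to the currently colored set `C` we add
every vertex `w` having a colored neighbor `v` with at most `k` non-colored neighbors. -/
def kForceStep {V : Type*} [Fintype V] [DecidableEq V] (G : SimpleGraph V)
    [DecidableRel G.Adj] (k : ℕ) (C : Finset V) : Finset V :=
  C ∪ Finset.univ.filter (fun w =>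
    ∃ v ∈ C, G.Adj v w ∧ ((G.neighborFinset v) \ C).card ≤ k)

/-- `S` is a `k`-forcing set: iterating the color change rule starting from `S`
eventually colors all vertices. -/
def IsKForcingSet {V : Type*} [Fintype V] [DecidableEq V] (G : SimpleGraph V)
    [DecidableRel G.Adj] (k : ℕ) (S : Finset V) : Prop :=
  (kForceStep G k)^[Fintype.card V] S = Finset.univ

/-- The `k`-forcing number: the minimum cardinality of a `k`-forcing set. -/
noncomputable def kForcingNumber {V : Type*} [Fintype V] [DecidableEq V] (G : SimpleGraph V)
    [DecidableRel G.Adj] (k : ℕ) : ℕ :=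
  sInf {m | ∃ S : Finset V, IsKForcingSet G k S ∧ S.card = m}

theorem subset_kForceStep {V : Type*} [Fintype V] [DecidableEq V] (G : SimpleGraph V)
    [DecidableRel G.Adj] (k : ℕ) (C : Finset V) : C ⊆ kForceStep G k C :=
  Finset.subset_union_left

theorem kForceStep_mono {V : Type*} [Fintype V] [DecidableEq V] (G : SimpleGraph V)
    [DecidableRel G.Adj] (k : ℕ) : Monotone (kForceStep G k) := by
  intro C D hCD w hw
  simp only [kForceStep, mem_union, mem_filter, mem_univ, true_and] at hw ⊢
  rcases hw with hw | ⟨v, hv, hvw, hcard⟩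
  · exact Or.inl (hCD hw)
  · exact Or.inr ⟨v, hCD hv, hvw,
      (card_le_card (sdiff_subset_sdiff (Finset.Subset.refl _) hCD)).trans hcard⟩

/-- Iterating an inflationary map on finsets either reaches a fixed point or adds at least one
element in every round. -/
theorem le_card_iterate_or_isFixedPt {V : Type*} {f : Finset V → Finset V}
    (hf : ∀ C, C ⊆ f C) (S : Finset V) (n : ℕ) :
    n ≤ (f^[n] S).card ∨ Function.IsFixedPt f (f^[n] S) := by
  induction n with
  | zero => exact Or.inl (Nat.zero_le _)
  | succ n ih =>
    rw [Function.iterate_succ_apply']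
    by_cases hfix : Function.IsFixedPt f (f^[n] S)
    · exact Or.inr (hfix.eq.symm ▸ hfix)
    · have hlt := card_lt_card ((hf (f^[n] S)).ssubset_of_ne (Ne.symm hfix))
      exact Or.inl (by have := ih.resolve_right hfix; omega)

theorem IsKForcingSet.of_subset_kForceStep {V : Type*} [Fintype V] [DecidableEq V]
    {G : SimpleGraph V} [DecidableRel G.Adj] {k : ℕ} {S T : Finset V}
    (hS : IsKForcingSet G k S) (hST : S ⊆ kForceStep G k T) : IsKForcingSet G k T := by
  have hsucc : kForceStep G k ((kForceStep G k)^[Fintype.card V] T) = Finset.univ := by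
    rw [← Function.iterate_succ_apply' (kForceStep G k), Function.iterate_succ_apply, ← univ_subset_iff]
    exact hS.symm.subset.trans ((kForceStep_mono G k).iterate _ hST)
  rcases le_card_iterate_or_isFixedPt (subset_kForceStep G k) T (Fintype.card V) with h | h
  · exact (card_eq_iff_eq_univ _).mp (le_antisymm (card_le_univ _) h)
  · exact h.eq.symm.trans hsucc

theorem kForcingNumber_le_card {V : Type*} [Fintype V] [DecidableEq V] {G : SimpleGraph V}
    [DecidableRel G.Adj] {k : ℕ} {S : Finset V} (hS : IsKForcingSet G k S) :
    kForcingNumber G k ≤ S.card :=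
  Nat.sInf_le ⟨S, hS, rfl⟩

/-- Lemma 1: If `G` has at least two vertices, minimum degree `δ ≥ 1`, and
`S` is a minimum `k`-forcing set, then every `v ∈ S` has at least `min {deg v, k}`
neighbors in `V - S`. -/
theorem min_kForcingSet_neighbors_outside {V : Type*} [Fintype V] [DecidableEq V]
    (G : SimpleGraph V) [DecidableRel G.Adj]
    (hn : 2 ≤ Fintype.card V) (hδ : 1 ≤ G.minDegree) (k : ℕ) (hk : 1 ≤ k)
    (S : Finset V) (hS : IsKForcingSet G k S) (hmin : S.card = kForcingNumber G k) :
    ∀ v ∈ S, min (G.degree v) k ≤ ((G.neighborFinset v) \ S).card := by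
  intro v hv
  by_contra! hlt
  obtain ⟨hdeg, hk'⟩ := lt_min_iff.mp hlt
  obtain ⟨w, hw, hwS⟩ : ∃ w ∈ G.neighborFinset v, w ∈ S := by
    by_contra! hout
    rw [sdiff_eq_self_of_disjoint (disjoint_left.mpr hout), card_neighborFinset_eq_degree] at hdeg
    exact lt_irrefl _ hdeg
  rw [mem_neighborFinset] at hw
  have hcard : (G.neighborFinset v \ S.erase w).card ≤ k := by
    have hsub : G.neighborFinset v \ S.erase w ⊆ insert w (G.neighborFinset v \ S) := by
      intro x
      simp only [mem_sdiff, mem_erase, mem_insert]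
      tauto
    exact (card_le_card hsub).trans ((card_insert_le _ _).trans hk')
  have hstep : S ⊆ kForceStep G k (S.erase w) := by
    intro x hx
    by_cases hxw : x = w
    · subst hxw
      simp only [kForceStep, mem_union, mem_filter, mem_univ, true_and]
      exact Or.inr ⟨v, mem_erase.mpr ⟨hw.ne, hv⟩, hw, hcard⟩
    · exact subset_kForceStep G k _ (mem_erase.mpr ⟨hxw, hx⟩)
  have hle := kForcingNumber_le_card (hS.of_subset_kForceStep hstep)
  have hcard_lt := card_erase_lt_of_mem hwS
  omega
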